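/- arXiv:2003.00778 — 4 statements merged into one kernel-verified Lean document; each statement's English description precedes it below -/
import Mathlib

section
/- Let (L_s) be the Lucas polynomials. For every natural number s, the polynomial L_s satisfies the Lucas differential equation (X^2 + 4)·L_s'' + X·L_s' − s^2·L_s = 0, i.e. as an identity in ℝ[X], (X^2 + 4) * (derivative (derivative (L s))) + X * derivative (L s) = (s^2 : ℝ[X]) * L s. -/
open Polynomial

/-- The Lucas polynomials: `L 0 = 2`, `L 1 = X`, `L (s+2) = X * L (s+1) + L s`. -/
noncomputable def lucas : ℕ → Polynomial ℝ
  | 0 => 2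
  | 1 => Polynomial.X
  | (s + 2) => Polynomial.X * lucas (s + 1) + lucas s

theorem lucas_add_two (s : ℕ) :
    lucas (s + 2) = Polynomial.X * lucas (s + 1) + lucas s := by
  rw [lucas]

/-- The derivative of a Lucas polynomial, expressed through Lucas polynomials. -/
theorem mul_derivative_lucas (s : ℕ) :
    (Polynomial.X ^ 2 + 4) * derivative (lucas s) =
      (s : Polynomial ℝ) * (2 * lucas (s + 1) - Polynomial.X * lucas s) := by
  induction s using Nat.twoStepInduction with
  | zero => simp [lucas]
  | one =>
    simp only [lucas, derivative_X, Nat.cast_one]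
    ring
  | more s ih₀ ih₁ =>
    rw [lucas_add_two (s + 1)]
    rw [lucas_add_two s] at ih₁ ⊢
    simp only [derivative_add, derivative_mul, derivative_X]
    push_cast at ih₁ ⊢
    linear_combination Polynomial.X * ih₁ + ih₀

/-- The Lucas polynomial `L s` satisfies the Lucas differential equation
`(X² + 4)·L'' + X·L' = s²·L` as an identity in `ℝ[X]`. -/
theorem lucas_differential_equation (s : ℕ) :
    (Polynomial.X ^ 2 + 4) * derivative (derivative (lucas s)) +
      Polynomial.X * derivative (lucas s) = (s : Polynomial ℝ) ^ 2 * lucas s := by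
  have hne : (Polynomial.X ^ 2 + 4 : Polynomial ℝ) ≠ 0 := fun h => by
    simpa using congrArg (Polynomial.eval 0) h
  have h₀ := mul_derivative_lucas s
  have h₁ := mul_derivative_lucas (s + 1)
  have hd := congrArg derivative h₀
  rw [lucas_add_two s] at h₁
  simp only [derivative_add, derivative_sub, derivative_mul, derivative_X, derivative_X_sq,
    derivative_natCast, derivative_ofNat, map_ofNat] at hd
  push_cast at h₁
  apply mul_left_cancel₀ hne
  linear_combination (Polynomial.X ^ 2 + 4) * hd + 2 * (s : Polynomial ℝ) * h₁ -
    (1 + (s : Polynomial ℝ)) * Polynomial.X * h₀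
end

section
/- Fix a natural number s ≥ 1 and regard the Lucas polynomial L_s as an element of ℂ[X] (via the canonical map ℝ[X] → ℂ[X]). For every j with 0 ≤ j ≤ s − 1, the complex number Θ_j = 2·i·cos((2j+1)π/(2s)) is a root of L_s, i.e. L_s(Θ_j) = 0; moreover the numbers Θ_0, Θ_1, …, Θ_{s−1} are pairwise distinct, so L_s (which has degree s) has precisely these s zeroes. -/
open Polynomial Complex

/-- The Lucas polynomials in terms of multiple angles. -/
theorem aeval_lucas_two_mul_I_mul_cos (θ : ℂ) (n : ℕ) :
    Polynomial.aeval (2 * Complex.I * Complex.cos θ) (lucas n) =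
      2 * Complex.I ^ n * Complex.cos (n * θ) := by
  induction n using Nat.twoStepInduction with
  | zero => simpa [lucas] using map_ofNat (Polynomial.aeval (2 * Complex.I * Complex.cos θ)) 2
  | one => simp [lucas]
  | more n ih₀ ih₁ =>
    have hcos : Complex.cos ((n + 2 : ℕ) * θ) =
        2 * Complex.cos θ * Complex.cos ((n + 1 : ℕ) * θ) - Complex.cos (n * θ) := by
      have h₂ : ((n + 2 : ℕ) : ℂ) * θ = (n + 1 : ℕ) * θ + θ := by push_cast; ring
      have h₀ : (n : ℂ) * θ = (n + 1 : ℕ) * θ - θ := by push_cast; ring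
      rw [h₂, h₀, Complex.cos_add, Complex.cos_sub]
      ring
    rw [lucas, map_add, map_mul, Polynomial.aeval_X, ih₀, ih₁, hcos]
    linear_combination (2 * Complex.I ^ n * Complex.cos (n * θ)) * Complex.I_sq

theorem natDegree_lucas_le_and_isMonicOfDegree (n : ℕ) :
    (lucas n).natDegree ≤ n ∧ Polynomial.IsMonicOfDegree (lucas (n + 1)) (n + 1) := by
  induction n with
  | zero =>
    refine ⟨?_, Polynomial.isMonicOfDegree_X ℝ⟩
    exact (Polynomial.natDegree_ofNat 2).le
  | succ n ih =>
    refine ⟨ih.2.natDegree_eq.le, ?_⟩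
    rw [lucas, add_comm (n + 1) 1]
    exact ((Polynomial.isMonicOfDegree_X ℝ).mul ih.2).add_right (by omega)

theorem natDegree_lucas (n : ℕ) : (lucas n).natDegree = n := by
  cases n with
  | zero => exact Nat.le_zero.mp (natDegree_lucas_le_and_isMonicOfDegree 0).1
  | succ n => exact (natDegree_lucas_le_and_isMonicOfDegree n).2.natDegree_eq

theorem odd_mul_pi_div_mem_Icc {s j : ℕ} (hj : j < s) :
    (2 * j + 1) * Real.pi / (2 * s) ∈ Set.Icc 0 Real.pi := by
  have hs : (0 : ℝ) < 2 * s := by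
    have : 0 < s := by omega
    positivity
  refine ⟨by positivity, ?_⟩
  rw [div_le_iff₀ hs, mul_comm Real.pi]
  have : (2 * j + 1 : ℝ) ≤ 2 * s := by
    exact_mod_cast (by omega : 2 * j + 1 ≤ 2 * s)
  gcongr

/-- For `s ≥ 1`, the numbers `Θ_j = 2 i cos((2j+1)π/(2s))`, `0 ≤ j ≤ s−1`, are pairwise
distinct roots of the Lucas polynomial `L s` (viewed over `ℂ`); since `L s` has degree `s`,
these are precisely its `s` zeroes. -/
theorem lucas_zeroes (s : ℕ) (hs : 1 ≤ s) :
    (∀ j : ℕ, j ≤ s - 1 →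
      Polynomial.aeval (2 * Complex.I * Complex.cos (((2 * j + 1) * Real.pi) / (2 * s)))
        (lucas s) = 0) ∧
    (∀ j k : ℕ, j ≤ s - 1 → k ≤ s - 1 → j ≠ k →
      (2 * Complex.I * Complex.cos (((2 * j + 1) * Real.pi) / (2 * s)) : ℂ) ≠
        2 * Complex.I * Complex.cos (((2 * k + 1) * Real.pi) / (2 * s))) ∧
    ((lucas s).map (algebraMap ℝ ℂ)).natDegree = s := by
  have hs₀ : (s : ℂ) ≠ 0 := by exact_mod_cast (by omega : s ≠ 0)
  refine ⟨fun j _ => ?_, fun j k hj hk hjk h => hjk ?_, ?_⟩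
  · rw [aeval_lucas_two_mul_I_mul_cos]
    have hangle : (s : ℂ) * ((2 * j + 1) * Real.pi / (2 * s)) = (2 * j + 1) * Real.pi / 2 := by
      field_simp
    rw [hangle, Complex.cos_eq_zero_iff.mpr ⟨j, by push_cast; rfl⟩, mul_zero]
  · have hcos := mul_left_cancel₀ (mul_ne_zero two_ne_zero Complex.I_ne_zero) h
    have hreal : Real.cos ((2 * j + 1) * Real.pi / (2 * s)) =
        Real.cos ((2 * k + 1) * Real.pi / (2 * s)) := by
      exact_mod_cast hcos
    have hangle := Real.injOn_cos (odd_mul_pi_div_mem_Icc (by omega))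
      (odd_mul_pi_div_mem_Icc (by omega)) hreal
    have hs₁ : (s : ℝ) ≠ 0 := by exact_mod_cast hs₀
    have hmul := (div_left_inj' (mul_ne_zero two_ne_zero hs₁)).mp hangle
    have hjk' : (2 * j + 1 : ℝ) = 2 * k + 1 := mul_right_cancel₀ Real.pi_ne_zero hmul
    exact_mod_cast (by linarith : (j : ℝ) = k)
  · rw [Polynomial.natDegree_map, natDegree_lucas]
end

section
/- Regard the Lucas polynomials L_s as elements of ℂ[X]. For all natural numbers s and h, the weighted inner product (1/4)·∫_0^π L_s(2·i·cos φ)·conj(L_h(2·i·cos φ)) dφ equals: 0 if s ≠ h; π/2 if s = h > 0; and π if s = h = 0. In particular the Lucas polynomials are orthogonal with respect to this inner product. -/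
open Polynomial Complex

/-- The substitution `x = 2 i cos φ` turns `L_s` into `2 iˢ cos (s φ)`. -/
theorem aeval_lucas_two_mul_I_mul_cos_s4 (z : ℂ) (s : ℕ) :
    aeval (2 * I * Complex.cos z) (lucas s) = 2 * I ^ s * Complex.cos (s * z) := by
  induction s using Nat.twoStepInduction with
  | zero => simpa [lucas] using map_ofNat (aeval (R := ℝ) (2 * I * Complex.cos z)) 2
  | one => simp [lucas]
  | more n ih₀ ih₁ =>
    have hc : Complex.cos ((n + 2 : ℕ) * z) =
        2 * Complex.cos z * Complex.cos ((n + 1 : ℕ) * z) - Complex.cos (n * z) := by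
      have h₁ := Complex.cos_add ((n + 1 : ℕ) * z) z
      have h₂ := Complex.cos_sub ((n + 1 : ℕ) * z) z
      rw [show ((n + 1 : ℕ) : ℂ) * z + z = (n + 2 : ℕ) * z by push_cast; ring] at h₁
      rw [show ((n + 1 : ℕ) : ℂ) * z - z = n * z by push_cast; ring] at h₂
      linear_combination h₁ + h₂
    rw [lucas, map_add, map_mul, aeval_X, ih₀, ih₁, hc]
    linear_combination 2 * I ^ n * Complex.cos (n * z) * I_sq

theorem integral_cos_mul_cos (s h : ℕ) :
    ∫ φ in (0 : ℝ)..Real.pi, Real.cos (s * φ) * Real.cos (h * φ) =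
      if s ≠ h then 0 else if s = 0 then Real.pi else Real.pi / 2 := by
  have key : ∫ φ in (0 : ℝ)..Real.pi, Real.cos (s * φ) * Real.cos (h * φ) =
      ∫ x, (Chebyshev.T ℝ s).eval x * (Chebyshev.T ℝ h).eval x ∂Chebyshev.measureT := by
    rw [Chebyshev.integral_measureT_eq_integral_cos]
    simp [Chebyshev.T_real_cos]
  rw [key]
  split_ifs with hsh hs
  · exact Chebyshev.integral_eval_T_real_mul_eval_T_real_measureT_of_ne hsh
  · obtain rfl := not_not.mp hsh
    subst hs
    exact Chebyshev.integral_eval_T_real_mul_self_measureT_zero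
  · obtain rfl := not_not.mp hsh
    exact Chebyshev.integral_T_real_mul_self_measureT_of_ne_zero hs

/-- Orthogonality of the Lucas polynomials: the weighted inner product
`(1/4)·∫_0^π L_s(2 i cos φ) · conj (L_h(2 i cos φ)) dφ` equals `0` if `s ≠ h`,
`π/2` if `s = h > 0`, and `π` if `s = h = 0`. -/
theorem lucas_orthogonality (s h : ℕ) :
    (1 / 4 : ℂ) * ∫ φ in (0 : ℝ)..Real.pi,
        Polynomial.aeval (2 * Complex.I * Complex.cos (φ : ℂ)) (lucas s) *
          (starRingEnd ℂ) (Polynomial.aeval (2 * Complex.I * Complex.cos (φ : ℂ)) (lucas h)) =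
      if s ≠ h then 0 else if s = 0 then (Real.pi : ℂ) else (Real.pi : ℂ) / 2 := by
  have hint : ∀ φ : ℝ, aeval (2 * I * Complex.cos (φ : ℂ)) (lucas s) *
      (starRingEnd ℂ) (aeval (2 * I * Complex.cos (φ : ℂ)) (lucas h)) =
      4 * (I ^ s * (-I) ^ h) * ((Real.cos (s * φ) * Real.cos (h * φ) : ℝ) : ℂ) := by
    intro φ
    rw [aeval_lucas_two_mul_I_mul_cos_s4, aeval_lucas_two_mul_I_mul_cos_s4]
    simp only [map_mul, map_pow, map_ofNat, conj_I, ← Complex.cos_conj, conj_ofReal, map_natCast]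
    push_cast
    ring
  simp_rw [hint]
  rw [intervalIntegral.integral_const_mul, intervalIntegral.integral_ofReal,
    integral_cos_mul_cos]
  by_cases hsh : s = h
  · subst hsh
    have hI : I ^ s * (-I) ^ s = 1 := by rw [← mul_pow]; simp
    rw [hI]
    split_ifs <;> simp_all
  · simp [hsh]
end

section
/- (Rodrigues' formula for Lucas polynomials.) For every natural number s and every real number x, L_s(x) = 2·(s! / (2s)!)·(x² + 4)^{1/2}·(d^s/dx^s)[(x² + 4)^{s − 1/2}], where d^s/dx^s denotes the s-th iterated derivative of the function x ↦ (x² + 4)^{s − 1/2} on ℝ. -/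
open Polynomial

/-- The Fibonacci polynomials: `F 0 = 0`, `F 1 = 1`, `F (s+2) = X * F (s+1) + F s`. -/
noncomputable def fibPoly : ℕ → Polynomial ℝ
  | 0 => 0
  | 1 => 1
  | (s + 2) => Polynomial.X * fibPoly (s + 1) + fibPoly s

theorem two_mul_fibPoly_succ (s : ℕ) :
    2 * fibPoly (s + 1) = X * fibPoly s + lucas s := by
  induction s using Nat.twoStepInduction with
  | zero => simp [fibPoly, lucas]
  | one => simp [fibPoly, lucas, two_mul]
  | more n h0 h1 =>
    rw [fibPoly, lucas]
    linear_combination X * h1 + h0 - X * fibPoly.eq_3 n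

theorem two_mul_lucas_succ (s : ℕ) :
    2 * lucas (s + 1) = X * lucas s + (X ^ 2 + 4) * fibPoly s := by
  induction s using Nat.twoStepInduction with
  | zero => simp [fibPoly, lucas, mul_comm]
  | one => simp only [fibPoly, lucas]; ring
  | more n h0 h1 =>
    rw [fibPoly, lucas]
    linear_combination X * h1 + h0 - X * lucas.eq_3 n

theorem derivative_lucas_and_fibPoly (s : ℕ) :
    derivative (lucas s) = (s : ℝ[X]) * fibPoly s ∧
      X * fibPoly s + (X ^ 2 + 4) * derivative (fibPoly s) = (s : ℝ[X]) * lucas s := by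
  induction s with
  | zero => simp [fibPoly, lucas]
  | succ s ih =>
    obtain ⟨hL, hF⟩ := ih
    have two_ne : (2 : ℝ[X]) ≠ 0 := two_ne_zero
    have hfib := two_mul_fibPoly_succ s
    have hluc := two_mul_lucas_succ s
    have hfib' := congrArg derivative hfib
    have hluc' := congrArg derivative hluc
    simp only [derivative_mul, derivative_add, derivative_X, derivative_X_pow,
      derivative_ofNat] at hfib' hluc'
    norm_num [show (C 2 : ℝ[X]) = 2 from rfl] at hfib' hluc'
    constructor <;> apply mul_left_cancel₀ two_ne <;> push_cast
    · linear_combination hluc' + hF + X * hL - (s + 1 : ℝ[X]) * hfib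
    · linear_combination X * hfib + (X ^ 2 + 4) * hfib' + (X ^ 2 + 4) * hL + X * hF -
        (s + 1 : ℝ[X]) * hluc

theorem iteratedDeriv_id_mul {f : ℝ → ℝ} (hf : ContDiff ℝ ⊤ f) (n : ℕ) :
    iteratedDeriv n (fun y => y * f y) =
      fun y => y * iteratedDeriv n f y + n * iteratedDeriv (n - 1) f y := by
  induction n with
  | zero => simp
  | succ n ih =>
    have hd (k : ℕ) (y : ℝ) :
        HasDerivAt (iteratedDeriv k f) (iteratedDeriv (k + 1) f y) y := by
      rw [iteratedDeriv_succ]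
      exact (hf.differentiable_iteratedDeriv k (by simp) y).hasDerivAt
    rw [iteratedDeriv_succ, ih]
    ext y
    refine (((hasDerivAt_id y).mul (hd n y)).add ((hd (n - 1) y).const_mul (n : ℝ))).deriv.trans ?_
    cases n with
    | zero => simp; ring
    | succ n => simp; ring

theorem contDiff_sq_add_four_rpow (p : ℝ) :
    ContDiff ℝ ⊤ (fun y : ℝ => (y ^ 2 + 4) ^ p) :=
  ContDiff.rpow_const_of_ne (by fun_prop) fun y => by positivity

theorem hasDerivAt_sq_add_four_rpow (p x : ℝ) :
    HasDerivAt (fun y : ℝ => (y ^ 2 + 4) ^ p) (2 * p * (x * (x ^ 2 + 4) ^ (p - 1))) x := by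
  have h : HasDerivAt (fun y : ℝ => y ^ 2 + 4) (2 * x) x := by
    simpa using (hasDerivAt_pow 2 x).add_const (4 : ℝ)
  convert h.rpow_const (p := p) (Or.inl (by positivity)) using 1
  ring

theorem iteratedDeriv_sq_add_four_rpow_rec (p x : ℝ) (n : ℕ) :
    (2 * (p + 1) - (n + 1)) * iteratedDeriv (n + 1) (fun y : ℝ => (y ^ 2 + 4) ^ (p + 1)) x =
      2 * (p + 1) * ((x ^ 2 + 4) * iteratedDeriv (n + 1) (fun y : ℝ => (y ^ 2 + 4) ^ p) x +
        (n + 1) * x * iteratedDeriv n (fun y : ℝ => (y ^ 2 + 4) ^ p) x) := by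
  have hq := contDiff_sq_add_four_rpow p
  have hxq : ContDiff ℝ ⊤ (fun y : ℝ => y * (y ^ 2 + 4) ^ p) := contDiff_id.mul hq
  have leibniz : iteratedDeriv (n + 1) (fun y : ℝ => (y ^ 2 + 4) ^ (p + 1)) x =
      (x ^ 2 + 4) * iteratedDeriv (n + 1) (fun y : ℝ => (y ^ 2 + 4) ^ p) x +
        2 * (n + 1) * x * iteratedDeriv n (fun y : ℝ => (y ^ 2 + 4) ^ p) x +
        (n + 1) * n * iteratedDeriv (n - 1) (fun y : ℝ => (y ^ 2 + 4) ^ p) x := by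
    have hsplit : (fun y : ℝ => (y ^ 2 + 4) ^ (p + 1)) =
        (fun y => y * (y * (y ^ 2 + 4) ^ p)) + fun y => 4 * (y ^ 2 + 4) ^ p := by
      ext y
      simp only [Pi.add_apply]
      rw [Real.rpow_add_one (by positivity)]
      ring
    have hxxq : ContDiff ℝ ⊤ (fun y : ℝ => y * (y * (y ^ 2 + 4) ^ p)) := contDiff_id.mul hxq
    have hcq : ContDiff ℝ ⊤ (fun y : ℝ => 4 * (y ^ 2 + 4) ^ p) := contDiff_const.mul hq
    rw [hsplit, iteratedDeriv_add (hxxq.of_le le_top).contDiffAt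
      (hcq.of_le le_top).contDiffAt,
      iteratedDeriv_const_mul _ (hq.of_le le_top).contDiffAt,
      iteratedDeriv_id_mul hxq, iteratedDeriv_id_mul hq, Nat.add_sub_cancel,
      iteratedDeriv_id_mul hq]
    push_cast
    ring
  have chain : iteratedDeriv (n + 1) (fun y : ℝ => (y ^ 2 + 4) ^ (p + 1)) x =
      2 * (p + 1) * (x * iteratedDeriv n (fun y : ℝ => (y ^ 2 + 4) ^ p) x +
        n * iteratedDeriv (n - 1) (fun y : ℝ => (y ^ 2 + 4) ^ p) x) := by
    have hderiv : deriv (fun y : ℝ => (y ^ 2 + 4) ^ (p + 1)) =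
        fun y => 2 * (p + 1) * (y * (y ^ 2 + 4) ^ p) := by
      ext y
      simpa using (hasDerivAt_sq_add_four_rpow (p + 1) y).deriv
    rw [iteratedDeriv_succ', hderiv, iteratedDeriv_const_mul _ (hxq.of_le le_top).contDiffAt,
      iteratedDeriv_id_mul hq]
  linear_combination 2 * (p + 1) * leibniz - (n + 1) * chain

theorem hasDerivAt_sqrt_mul_fibPoly (s : ℕ) (x : ℝ) :
    HasDerivAt (fun y : ℝ => (y ^ 2 + 4) ^ (1 / 2 : ℝ) * (fibPoly s).eval y)
      (s * (lucas s).eval x * (x ^ 2 + 4) ^ (-1 / 2 : ℝ)) x := by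
  have hF := congrArg (Polynomial.eval x) (derivative_lucas_and_fibPoly s).2
  simp at hF
  have hroot : (x ^ 2 + 4) ^ (1 / 2 : ℝ) = (x ^ 2 + 4) ^ (-1 / 2 : ℝ) * (x ^ 2 + 4) := by
    rw [← Real.rpow_add_one (by positivity)]
    norm_num
  refine ((hasDerivAt_sq_add_four_rpow (1 / 2) x).mul ((fibPoly s).hasDerivAt x)).congr_deriv ?_
  rw [hroot, show (1 / 2 - 1 : ℝ) = -1 / 2 by norm_num]
  linear_combination (x ^ 2 + 4) ^ (-1 / 2 : ℝ) * hF

theorem iteratedDeriv_succ_of_fibPoly {f : ℝ → ℝ} {n s : ℕ} {c : ℝ}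
    (h : ∀ x, iteratedDeriv n f x = c * ((x ^ 2 + 4) ^ (1 / 2 : ℝ) * (fibPoly s).eval x)) (x : ℝ) :
    iteratedDeriv (n + 1) f x = c * (s * (lucas s).eval x * (x ^ 2 + 4) ^ (-1 / 2 : ℝ)) := by
  rw [iteratedDeriv_succ, funext h]
  exact ((hasDerivAt_sqrt_mul_fibPoly s x).const_mul c).deriv

theorem iteratedDeriv_eq_sqrt_mul_fibPoly (n : ℕ) (x : ℝ) :
    iteratedDeriv n (fun y : ℝ => (y ^ 2 + 4) ^ ((n : ℝ) + 1 / 2)) x =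
      ((2 * (n + 1)).factorial : ℝ) / (2 * (n + 1).factorial * (n + 1)) *
        ((x ^ 2 + 4) ^ (1 / 2 : ℝ) * (fibPoly (n + 1)).eval x) := by
  induction n generalizing x with
  | zero => simp [fibPoly]
  | succ n ih =>
    have hrec := iteratedDeriv_sq_add_four_rpow_rec ((n : ℝ) + 1 / 2) x n
    rw [iteratedDeriv_succ_of_fibPoly ih, ih] at hrec
    have hfib := congrArg (Polynomial.eval x) (two_mul_fibPoly_succ (n + 1))
    simp at hfib
    have hroot : (x ^ 2 + 4) ^ (1 / 2 : ℝ) = (x ^ 2 + 4) ^ (-1 / 2 : ℝ) * (x ^ 2 + 4) := by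
      rw [← Real.rpow_add_one (by positivity)]
      norm_num
    rw [hroot] at hrec ⊢
    have hn : ((n : ℝ) + 2) ≠ 0 := by positivity
    rw [show ((n + 1 : ℕ) : ℝ) + 1 / 2 = n + 1 / 2 + 1 by push_cast; ring]
    apply mul_left_cancel₀ hn
    rw [show 2 * (n + 1 + 1) = 2 * (n + 1) + 1 + 1 by ring, Nat.factorial_succ (2 * (n + 1) + 1),
      Nat.factorial_succ (2 * (n + 1)), Nat.factorial_succ (n + 1)]
    push_cast at hrec ⊢
    have step : ((n : ℝ) + 2) *
        iteratedDeriv (n + 1) (fun y : ℝ => (y ^ 2 + 4) ^ ((n : ℝ) + 1 / 2 + 1)) x =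
        (2 * n + 3) * (((2 * (n + 1)).factorial : ℝ) / (2 * (n + 1).factorial)) *
          ((x ^ 2 + 4) ^ (-1 / 2 : ℝ) * (x ^ 2 + 4)) * (2 * (fibPoly (n + 1 + 1)).eval x) := by
      rw [hfib]
      field_simp at hrec ⊢
      linear_combination hrec
    rw [step]
    field_simp
    ring

/-- Rodrigues' formula for the Lucas polynomials:
`L s x = 2·(s!/(2s)!)·(x²+4)^{1/2}·(d/dx)^s [(x²+4)^{s−1/2}]`. -/
theorem lucas_rodrigues_formula (s : ℕ) (x : ℝ) :
    (lucas s).eval x =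
      2 * ((s.factorial : ℝ) / ((2 * s).factorial : ℝ)) * (x ^ 2 + 4) ^ (1 / 2 : ℝ) *
        iteratedDeriv s (fun y : ℝ => (y ^ 2 + 4) ^ ((s : ℝ) - 1 / 2)) x := by
  cases s with
  | zero =>
    have hpos : (0 : ℝ) < x ^ 2 + 4 := by positivity
    simp [lucas, mul_assoc, ← Real.rpow_add hpos]
  | succ n =>
    have hpos : (0 : ℝ) < x ^ 2 + 4 := by positivity
    have hroot : (x ^ 2 + 4) ^ (1 / 2 : ℝ) * (x ^ 2 + 4) ^ (-1 / 2 : ℝ) = 1 := by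
      rw [← Real.rpow_add hpos]
      norm_num
    rw [show ((n + 1 : ℕ) : ℝ) - 1 / 2 = n + 1 / 2 by push_cast; ring,
      iteratedDeriv_succ_of_fibPoly (iteratedDeriv_eq_sqrt_mul_fibPoly n)]
    push_cast
    calc (lucas (n + 1)).eval x
        = (lucas (n + 1)).eval x *
            ((x ^ 2 + 4) ^ (1 / 2 : ℝ) * (x ^ 2 + 4) ^ (-1 / 2 : ℝ)) := by rw [hroot, mul_one]
      _ = _ := by field_simp
end
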